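/- Let Y ⊂ ℙᴺ be an irreducible hypersurface of degree d > 1 with nonvanishing Hessian (pdef Y = 0) and let L ⊂ ℙᴺ be a general hyperplane. Then the hyperplane section Y_L = Y ∩ L also has nonvanishing Hessian (pdef Y_L = 0). More generally, either pdef Y = pdef Y_L = 0 or pdef Y = pdef Y_L + 1. -/

import Mathlib

/-!
STATEMENT 13: Let `Y = {F = 0} ⊂ ℙᴺ` be an irreducible hypersurface of degree `d > 1`
and `L` a general hyperplane.  Then either `pdef Y = pdef Y_L = 0` or
`pdef Y = pdef Y_L + 1`; in particular if `Y` has nonvanishing Hessian then so does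
`Y ∩ L`.  A hyperplane is given by a (generic) linear embedding `ℂᴺ → ℂ^{N+1}` encoded
by a matrix `M`, and `Y_L` is defined by the pullback `G_M` of `F`.  With `Ẑ`, `Ẑ_L`
the affine cones over the polar images (`pdef Y = (N+1) − dim Ẑ`,
`pdef Y_L = N − dim Ẑ_L`), the dichotomy reads:
either (`dim Ẑ = N+1` and `dim Ẑ_L = N`) — both polar defects vanish — or
`dim Ẑ = dim Ẑ_L` — i.e. `pdef Y = pdef Y_L + 1`.  "General" means: valid for all `M`
in the complement of the zero locus of some nonzero polynomial in the entries of `M`.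
-/

open MvPolynomial

def zcl {σ : Type*} (S : Set (σ → ℂ)) : Set (σ → ℂ) :=
  {x | ∀ p : MvPolynomial σ ℂ, (∀ y ∈ S, eval y p = 0) → eval x p = 0}

def ZClosed {σ : Type*} (S : Set (σ → ℂ)) : Prop := zcl S = S

def ZIrr {σ : Type*} (S : Set (σ → ℂ)) : Prop :=
  S.Nonempty ∧ ∀ C₁ C₂ : Set (σ → ℂ), ZClosed C₁ → ZClosed C₂ →
    S ⊆ C₁ ∪ C₂ → (S ⊆ C₁ ∨ S ⊆ C₂)

noncomputable def adim {σ : Type*} (S : Set (σ → ℂ)) : WithBot ℕ∞ :=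
  Order.krullDim {T : Set (σ → ℂ) // ZIrr T ∧ ZClosed T ∧ T ⊆ S}

/-- The (affine) polar map of a hypersurface `{F = 0}` in the affine space `σ → ℂ`. -/
noncomputable def polarMap {σ : Type*} (F : MvPolynomial σ ℂ)
    (x : σ → ℂ) : σ → ℂ :=
  fun i => eval x (pderiv i F)

theorem Matrix.exists_linearIndependent_rows {K m n : Type*} [Field K] [Fintype m] [Fintype n]
    (A : Matrix m n K) {s : ℕ} (hs : s ≤ A.rank) :
    ∃ e : Fin s → m, LinearIndependent K (A.submatrix e id).row := by
  rw [Matrix.rank_eq_finrank_span_row] at hs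
  obtain ⟨g, hg, -, hli⟩ := Submodule.exists_fun_fin_finrank_span_eq K (Set.range A.row)
  choose e he using hg
  refine ⟨e ∘ Fin.castLE hs, ?_⟩
  have h := hli.comp (Fin.castLE hs) (Fin.castLE_injective hs)
  rwa [← funext he] at h

theorem Matrix.exists_submatrix_det_ne_zero {K m n : Type*} [Field K] [Fintype m] [Fintype n]
    (A : Matrix m n K) {s : ℕ} (hs : s ≤ A.rank) :
    ∃ (e : Fin s → m) (f : Fin s → n), (A.submatrix e f).det ≠ 0 := by
  obtain ⟨e, he⟩ := A.exists_linearIndependent_rows hs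
  have h1 : s ≤ ((A.submatrix e id).transpose).rank := by
    rw [Matrix.rank_transpose, he.rank_matrix]; simp
  obtain ⟨f, hf⟩ := Matrix.exists_linearIndependent_rows _ h1
  refine ⟨e, f, ?_⟩
  rw [← Matrix.det_transpose, ← isUnit_iff_ne_zero, ← Matrix.isUnit_iff_isUnit_det,
    ← Matrix.linearIndependent_rows_iff_isUnit]
  exact hf

theorem Algebra.IsIntegral.ringKrullDim_eq_of_injective {R S : Type*} [CommRing R] [CommRing S]
    [IsDomain S] [Algebra R S] [Algebra.IsIntegral R S] (h : Function.Injective (algebraMap R S)) :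
    ringKrullDim R = ringKrullDim S := by
  apply le_antisymm
  · refine iSup_le fun l => ?_
    obtain ⟨Q, hQ, hQl⟩ := Ideal.exists_ideal_over_prime_of_isIntegral_of_isDomain
      (S := S) l.head.asIdeal (by rw [(RingHom.injective_iff_ker_eq_bot _).mp h]; exact bot_le)
    have : Q.LiesOver l.head.asIdeal := ⟨hQl.symm⟩
    obtain ⟨L, hL, -⟩ := Ideal.exists_ltSeries_of_hasGoingUp l Q
    rw [← hL]
    exact Order.LTSeries.length_le_krullDim L
  · refine Order.krullDim_le_of_strictMono (PrimeSpectrum.comap (algebraMap R S)) ?_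
    intro p q hpq
    exact Ideal.IsIntegral.comap_lt_comap hpq

theorem ringKrullDim_eq_trdeg (k A : Type*) [Field k] [CommRing A] [IsDomain A] [Algebra k A]
    [Algebra.FiniteType k A] :
    ringKrullDim A = ((Cardinal.toNat (Algebra.trdeg k A) : ℕ) : ℕ∞) := by
  obtain ⟨s, g, hg, hi⟩ := exists_integral_inj_algHom_of_fg k A
  algebraize [g.toRingHom]
  have : Algebra.IsIntegral (MvPolynomial (Fin s) k) A := ⟨hi⟩
  have ht : IsScalarTower k (MvPolynomial (Fin s) k) A := by
    refine IsScalarTower.of_algebraMap_eq fun x => (g.commutes x).symm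
  have hinj : Function.Injective (algebraMap (MvPolynomial (Fin s) k) A) := hg
  rw [← Algebra.IsIntegral.ringKrullDim_eq_of_injective hinj]
  have hf : FaithfulSMul (MvPolynomial (Fin s) k) A :=
    (faithfulSMul_iff_algebraMap_injective _ _).mpr hinj
  have h1 := lift_trdeg_add_eq k (MvPolynomial (Fin s) k) A
  rw [trdeg_eq_zero (R := MvPolynomial (Fin s) k) (A := A)] at h1
  have h2 : Cardinal.toNat (Algebra.trdeg k A) = s := by
    have := congrArg Cardinal.toNat h1
    simpa using this.symm
  rw [h2]
  simp [ringKrullDim_eq_zero_of_field]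

theorem zcl_eq_zeroLocus {σ : Type*} (S : Set (σ → ℂ)) :
    zcl S = zeroLocus ℂ (vanishingIdeal ℂ S) := by
  ext x
  simp [zcl, mem_zeroLocus_iff, mem_vanishingIdeal_iff, aeval_eq_eval]

theorem ZClosed.zeroLocus_vanishingIdeal {σ : Type*} {T : Set (σ → ℂ)} (hT : ZClosed T) :
    zeroLocus ℂ (vanishingIdeal ℂ T) = T := by
  rw [← zcl_eq_zeroLocus, hT]

theorem zClosed_zeroLocus {σ : Type*} (I : Ideal (MvPolynomial σ ℂ)) : ZClosed (zeroLocus ℂ I) := by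
  rw [ZClosed, zcl_eq_zeroLocus]
  exact zeroLocus_vanishingIdeal_galoisConnection.l_u_l_eq_l I

theorem ZIrr.isPrime_vanishingIdeal {σ : Type*} {T : Set (σ → ℂ)} (hT : ZIrr T) :
    (vanishingIdeal ℂ T).IsPrime := by
  obtain ⟨⟨x, hx⟩, hT⟩ := hT
  refine ⟨fun h => ?_, fun {f g} hfg => ?_⟩
  · have : (1 : MvPolynomial σ ℂ) ∈ vanishingIdeal ℂ T := h ▸ Submodule.mem_top
    simpa using this x hx
  · have := hT _ _ (zClosed_zeroLocus (Ideal.span {f})) (zClosed_zeroLocus (Ideal.span {g}))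
      (fun y hy => by
        have := hfg y hy
        simpa [zeroLocus_span] using this)
    refine this.imp (fun h y hy => ?_) (fun h y hy => ?_) <;>
    simpa [zeroLocus_span] using h hy

theorem zIrr_zeroLocus {σ : Type*} [Finite σ] (P : Ideal (MvPolynomial σ ℂ)) [hP : P.IsPrime] :
    ZIrr (zeroLocus ℂ P) := by
  have hv : vanishingIdeal ℂ (zeroLocus ℂ P) = P := IsPrime.vanishingIdeal_zeroLocus P
  refine ⟨?_, fun C₁ C₂ h₁ h₂ hsub => ?_⟩
  · by_contra! h
    rw [h] at hv
    exact hP.ne_top (by rw [← hv]; exact vanishingIdeal_empty)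
  · by_contra! h
    have aux : ∀ C : Set (σ → ℂ), ZClosed C → ¬ zeroLocus ℂ P ⊆ C →
        ∃ f ∈ vanishingIdeal ℂ C, f ∉ P := by
      intro C hC hn
      by_contra! hle
      exact hn ((zeroLocus_anti_mono hle).trans hC.zeroLocus_vanishingIdeal.le)
    obtain ⟨f, hf, hfP⟩ := aux C₁ h₁ h.1
    obtain ⟨g, hg, hgP⟩ := aux C₂ h₂ h.2
    have hfg : f * g ∈ vanishingIdeal ℂ (zeroLocus ℂ P) := by
      intro x hx
      rcases hsub hx with hx | hx
      · rw [map_mul, hf x hx, zero_mul]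
      · rw [map_mul, hg x hx, mul_zero]
    rw [hv] at hfg
    exact (hP.mem_or_mem hfg).elim hfP hgP

theorem adim_zeroLocus {σ : Type*} [Finite σ] (P : Ideal (MvPolynomial σ ℂ)) [P.IsPrime] :
    adim (zeroLocus ℂ P) = ringKrullDim (MvPolynomial σ ℂ ⧸ P) := by
  rw [ringKrullDim_quotient, ← Order.krullDim_orderDual, adim]
  have hmem : ∀ Q : PrimeSpectrum.zeroLocus (P : Set (MvPolynomial σ ℂ)),
      vanishingIdeal ℂ (zeroLocus ℂ Q.1.asIdeal) = Q.1.asIdeal :=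
    fun Q => IsPrime.vanishingIdeal_zeroLocus Q.1.asIdeal
  refine Order.krullDim_eq_of_orderIso
    { toFun := fun T => OrderDual.toDual ⟨⟨vanishingIdeal ℂ T.1, T.2.1.isPrime_vanishingIdeal⟩,
        le_zeroLocus_iff_le_vanishingIdeal.mp T.2.2.2⟩
      invFun := fun Q => ⟨zeroLocus ℂ (OrderDual.ofDual Q).1.asIdeal,
        zIrr_zeroLocus _, zClosed_zeroLocus _, zeroLocus_anti_mono (OrderDual.ofDual Q).2⟩
      left_inv := fun T => Subtype.ext T.2.2.1.zeroLocus_vanishingIdeal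
      right_inv := fun Q => by
        apply OrderDual.ofDual.injective
        exact Subtype.ext (PrimeSpectrum.ext (hmem _))
      map_rel_iff' := ?_ }
  intro T T'
  change vanishingIdeal ℂ T'.1 ≤ vanishingIdeal ℂ T.1 ↔ T.1 ⊆ T'.1
  rw [← le_zeroLocus_iff_le_vanishingIdeal, T'.2.2.1.zeroLocus_vanishingIdeal]

/-- The Zariski closure of the image of a polynomial map has dimension the transcendence degree
of the algebra generated by its coordinates. -/
theorem adim_zcl_range {σ τ : Type*} [Finite σ] [Finite τ] (φ : τ → MvPolynomial σ ℂ) :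
    adim (zcl (Set.range fun (x : σ → ℂ) i => eval x (φ i))) =
      ((Cardinal.toNat (Algebra.trdeg ℂ (Algebra.adjoin ℂ (Set.range φ))) : ℕ) : ℕ∞) := by
  have hker : vanishingIdeal ℂ (Set.range fun (x : σ → ℂ) i => eval x (φ i)) =
      RingHom.ker (aeval φ : MvPolynomial τ ℂ →ₐ[ℂ] MvPolynomial σ ℂ) := by
    ext p
    rw [mem_vanishingIdeal_iff, RingHom.mem_ker, MvPolynomial.funext_iff, Set.forall_mem_range]
    refine forall_congr' fun x => ?_
    have : eval x (aeval φ p) = aeval (fun i => eval x (φ i)) p := by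
      rw [← aeval_eq_eval, ← AlgHom.coe_toRingHom]
      exact congrArg (fun f : MvPolynomial τ ℂ →ₐ[ℂ] ℂ => f p)
        (comp_aeval φ (aeval x : MvPolynomial σ ℂ →ₐ[ℂ] ℂ))
    rw [this, map_zero]
  rw [zcl_eq_zeroLocus, hker]
  have : (RingHom.ker (aeval φ : MvPolynomial τ ℂ →ₐ[ℂ] MvPolynomial σ ℂ)).IsPrime :=
    RingHom.ker_isPrime _
  rw [adim_zeroLocus]
  have : Algebra.FiniteType ℂ (Algebra.adjoin ℂ (Set.range φ)) :=
    (Subalgebra.fg_iff_finiteType _).mp (by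
      rw [← (Set.finite_range φ).coe_toFinset]; exact Subalgebra.fg_adjoin_finset _)
  rw [← ringKrullDim_eq_trdeg, Algebra.adjoin_range_eq_range_aeval]
  exact ringKrullDim_eq_of_ringEquiv
    (Ideal.quotientKerEquivRange (aeval φ : MvPolynomial τ ℂ →ₐ[ℂ] MvPolynomial σ ℂ)).toRingEquiv

theorem MvPolynomial.totalDegree_pderiv_lt {R σ : Type*} [CommSemiring R] (i : σ)
    {p : MvPolynomial σ R} (hp : p.totalDegree ≠ 0) :
    (pderiv i p).totalDegree < p.totalDegree := by
  rw [totalDegree, Finset.sup_lt_iff (by simpa using Nat.pos_of_ne_zero hp)]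
  intro m hm
  rw [mem_support_iff, coeff_pderiv] at hm
  have hm' : m + Finsupp.single i 1 ∈ p.support := by
    rw [mem_support_iff]
    intro h
    simp [h] at hm
  have h := le_totalDegree hm'
  rw [Finsupp.sum_add_index' (by simp) (by simp)] at h
  simp at h
  exact h

theorem MvPolynomial.eq_C_of_pderiv_eq_zero {R σ : Type*} [CommRing R] [IsDomain R] [CharZero R]
    {p : MvPolynomial σ R} (hp : ∀ i, pderiv i p = 0) : p = C (coeff 0 p) := by
  classical
  ext m
  rw [coeff_C]
  split_ifs with h
  · rw [h]
  · obtain ⟨i, hi⟩ : ∃ i, m i ≠ 0 := by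
      by_contra! h'
      exact h (Finsupp.ext h').symm
    have h1 := congrArg (coeff (m - Finsupp.single i 1)) (hp i)
    rw [coeff_pderiv, coeff_zero, tsub_add_cancel_of_le (by
      simpa using Nat.one_le_iff_ne_zero.mpr hi)] at h1
    refine (mul_eq_zero.mp h1).resolve_right ?_
    exact Nat.cast_add_one_ne_zero _

theorem MvPolynomial.pderiv_aeval {R σ τ : Type*} [CommRing R] [Fintype τ] (i : σ)
    (φ : τ → MvPolynomial σ R) (p : MvPolynomial τ R) :
    pderiv i (aeval φ p) = ∑ k, aeval φ (pderiv k p) * pderiv i (φ k) := by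
  classical
  induction p using MvPolynomial.induction_on with
  | C a => simp
  | add p q hp hq => simp only [map_add, hp, hq, add_mul, Finset.sum_add_distrib]
  | mul_X p k hp =>
    simp only [map_mul, aeval_X, Derivation.leibniz, hp, smul_eq_mul, map_add, pderiv_X, add_mul,
      Finset.sum_add_distrib, Finset.mul_sum]
    congr 1
    · rw [Finset.sum_eq_single k (by intro b _ hb; simp [hb.symm]) (by simp)]
      simp
    · exact Finset.sum_congr rfl fun x _ => by ring

/-- The Jacobian criterion: polynomials with a nonvanishing Jacobian minor are algebraically
independent. -/
theorem MvPolynomial.algebraicIndependent_of_det_ne_zero {R σ : Type*} [CommRing R] [IsDomain R]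
    [CharZero R] {s : ℕ} (φ : Fin s → MvPolynomial σ R) (f : Fin s → σ)
    (h : (Matrix.of fun i j => pderiv (f j) (φ i)).det ≠ 0) : AlgebraicIndependent R φ := by
  rw [algebraicIndependent_iff]
  intro p
  induction hn : p.totalDegree using Nat.strong_induction_on generalizing p with
  | _ n ih =>
  intro hp
  have hC : ∀ {q : MvPolynomial (Fin s) R} {c : R}, q = C c → aeval φ q = 0 → q = 0 := by
    rintro q c rfl hq
    rw [aeval_C, algebraMap_eq, C_eq_zero] at hq
    rw [hq, C_0]
  by_cases h0 : p.totalDegree = 0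
  · exact hC (totalDegree_eq_zero_iff_eq_C.mp h0) hp
  · have h1 : (fun k => aeval φ (pderiv k p)) = 0 := by
      refine Matrix.eq_zero_of_vecMul_eq_zero h ?_
      funext j
      have := pderiv_aeval (f j) φ p
      rw [hp, map_zero] at this
      simpa [Matrix.vecMul, dotProduct] using this.symm
    exact hC (eq_C_of_pderiv_eq_zero fun k =>
      ih _ (hn ▸ totalDegree_pderiv_lt k h0) _ rfl (congrFun h1 k)) hp

theorem Derivation.eq_zero_of_coeff {R A K : Type*} [CommRing R] [CommRing A] [CharZero A]
    [IsDomain A] [Algebra R A] [Field K] [Algebra A K] [FaithfulSMul A K] [Algebra R K]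
    (D : Derivation R A K) {x : A} {p : Polynomial A} (hp : p ≠ 0)
    (hD : ∀ i, D (p.coeff i) = 0) (hx : p.eval x = 0) : D x = 0 := by
  induction hn : p.natDegree using Nat.strong_induction_on generalizing p with
  | _ n ih =>
  have key : ∀ q : Polynomial A, (∀ i, D (q.coeff i) = 0) →
      D (q.eval x) = q.derivative.eval x • D x := by
    intro q hq
    rw [Polynomial.eval_eq_sum_range, Polynomial.derivative_eval,
      Polynomial.sum_over_range' _ _ (q.natDegree + 1) (Nat.lt_succ_self _)]
    · simp only [map_sum, Derivation.leibniz, Finset.sum_smul, hq, Derivation.leibniz_pow]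
      refine Finset.sum_congr rfl fun i _ => ?_
      simp only [← Nat.cast_smul_eq_nsmul A, smul_smul, smul_zero, add_zero]
      congr 1
      ring
    · simp
  have h1 := key p hD
  rw [hx, map_zero] at h1
  by_contra hDx
  have h2 : p.derivative.eval x = 0 := by
    have := smul_eq_zero.mp h1.symm
    exact this.resolve_right hDx
  have hd : p.natDegree ≠ 0 := by
    intro h0
    rw [Polynomial.eq_C_of_natDegree_eq_zero h0] at hx hp
    simp at hx hp
    exact hp hx
  refine hDx (ih _ (hn ▸ Polynomial.natDegree_derivative_lt hd) ?_ ?_ h2 rfl)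
  · intro h0
    exact hd (Polynomial.derivative_eq_zero.mp h0)
  · intro i
    rw [Polynomial.coeff_derivative]
    have : D ((i : A) + 1) = 0 := by simp
    simp [Derivation.leibniz, hD, this]

theorem Derivation.eq_zero_of_isAlgebraic {R A K : Type*} [CommRing R] [CommRing A] [CharZero A]
    [IsDomain A] [Algebra R A] [Field K] [Algebra A K] [FaithfulSMul A K] [Algebra R K]
    (D : Derivation R A K) (S : Subring A) (hS : ∀ x ∈ S, D x = 0) {x : A}
    (hx : IsAlgebraic S x) : D x = 0 := by
  obtain ⟨p, hp, hpx⟩ := hx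
  refine D.eq_zero_of_coeff (p := p.map (algebraMap S A)) ?_ (fun i => ?_) ?_
  · rwa [Ne, Polynomial.map_eq_zero_iff Subtype.val_injective]
  · rw [Polynomial.coeff_map]
    exact hS _ (p.coeff i).2
  · rw [Polynomial.eval_map_algebraMap]; exact hpx

theorem Subalgebra.exists_isTranscendenceBasis_of_adjoin_eq_top {k A : Type*} [Field k]
    [CommRing A] [IsDomain A] [Algebra k A] (S : Subalgebra k A) {s : Set A}
    (hs : Algebra.adjoin k s = ⊤) : ∃ t ⊆ s, IsTranscendenceBasis S ((↑) : t → A) := by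
  have htop : Algebra.adjoin S s = ⊤ := by
    rw [eq_top_iff]
    intro p _
    have h : p ∈ Algebra.adjoin k s := hs ▸ trivial
    induction h using Algebra.adjoin_induction with
    | mem x hx => exact Algebra.subset_adjoin hx
    | algebraMap r =>
      exact (Algebra.adjoin S s).algebraMap_mem (algebraMap k S r)
    | add x y _ _ hx hy => exact add_mem (hx trivial) (hy trivial)
    | mul x y _ _ hx hy => exact mul_mem (hx trivial) (hy trivial)
  have : Algebra.IsAlgebraic (Algebra.adjoin S s) A := by
    rw [htop]
    exact ⟨fun a => isAlgebraic_algebraMap (⟨a, trivial⟩ : (⊤ : Subalgebra S A))⟩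
  exact exists_isTranscendenceBasis_subset s

theorem Subalgebra.toNat_trdeg_add_card {k A : Type*} [Field k]
    [CommRing A] [IsDomain A] [Algebra k A] (S : Subalgebra k A) {t : Set A} [Fintype t]
    (ht : IsTranscendenceBasis S ((↑) : t → A)) {n : ℕ} (hn : Algebra.trdeg k A = n) :
    Cardinal.toNat (Algebra.trdeg k S) + Fintype.card t = n := by
  have h1 := trdeg_add_eq k S (A := A)
  rw [← ht.cardinalMk_eq_trdeg, Cardinal.mk_fintype, hn] at h1
  have hlt : Algebra.trdeg k S < Cardinal.aleph0 :=
    lt_of_le_of_lt (h1 ▸ self_le_add_right _ _) Cardinal.natCast_lt_aleph0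
  have h2 := congrArg Cardinal.toNat h1
  rwa [Cardinal.toNat_add hlt Cardinal.natCast_lt_aleph0, Cardinal.toNat_natCast,
    Cardinal.toNat_natCast] at h2

theorem MvPolynomial.mkDerivation_eq_sum {k σ K : Type*} [CommRing k] [Fintype σ] [CommRing K]
    [Algebra k K] [Algebra (MvPolynomial σ k) K] [IsScalarTower k (MvPolynomial σ k) K]
    (a : σ → K) (p : MvPolynomial σ k) :
    mkDerivation k a p = ∑ j, algebraMap (MvPolynomial σ k) K (pderiv j p) * a j := by
  classical
  induction p using MvPolynomial.induction_on with
  | C r => simp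
  | add p q hp hq => simp only [map_add, hp, hq, add_mul, Finset.sum_add_distrib]
  | mul_X p i hp =>
    simp only [Derivation.leibniz, hp, mkDerivation_X, pderiv_X, smul_eq_mul, map_add, map_mul,
      add_mul, Finset.sum_add_distrib, Algebra.smul_def, Finset.mul_sum, mul_assoc]
    congr 1
    rw [Finset.sum_eq_single i (by intro b _ hb; simp [hb.symm]) (by simp)]
    simp

theorem Derivation.eq_zero_of_isTranscendenceBasis {k A K : Type*} [Field k] [CommRing A]
    [CharZero A] [IsDomain A] [Algebra k A] [Field K] [Algebra A K] [FaithfulSMul A K] [Algebra k K]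
    [IsScalarTower k A K] (D : Derivation k A K) {s t : Set A}
    (ht : IsTranscendenceBasis (Algebra.adjoin k s) ((↑) : t → A))
    (hDs : ∀ p ∈ s, D p = 0) (hDt : ∀ p ∈ t, D p = 0) (p : A) : D p = 0 := by
  have hS : ∀ p ∈ Algebra.adjoin k s, D p = 0 := by
    intro p hp
    induction hp using Algebra.adjoin_induction with
    | mem x hx => exact hDs x hx
    | algebraMap r => simp
    | add x y _ _ hx hy => simp [hx, hy]
    | mul x y _ _ hx hy => simp [hx, hy]
  have hT : ∀ p ∈ Algebra.adjoin (Algebra.adjoin k s) t, D p = 0 := by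
    intro p hp
    induction hp using Algebra.adjoin_induction with
    | mem x hx => exact hDt x hx
    | algebraMap r => exact hS _ r.2
    | add x y _ _ hx hy => simp [hx, hy]
    | mul x y _ _ hx hy => simp [hx, hy]
  have halg := ht.isAlgebraic
  rw [Subtype.range_coe] at halg
  exact D.eq_zero_of_isAlgebraic (Algebra.adjoin (Algebra.adjoin k s) t).toSubring hT
    (halg.isAlgebraic p)

/-- In characteristic zero, the Jacobian matrix has rank at least the transcendence degree. -/
theorem MvPolynomial.trdeg_adjoin_le_rank {k σ τ K : Type*} [Field k] [CharZero k] [Fintype σ]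
    [Fintype τ] [Field K] [Algebra (MvPolynomial σ k) K] [FaithfulSMul (MvPolynomial σ k) K]
    [Algebra k K] [IsScalarTower k (MvPolynomial σ k) K] (φ : τ → MvPolynomial σ k) :
    Cardinal.toNat (Algebra.trdeg k (Algebra.adjoin k (Set.range φ))) ≤
      (Matrix.of fun i j => algebraMap (MvPolynomial σ k) K (pderiv j (φ i))).rank := by
  classical
  obtain ⟨t, ht, hbasis⟩ :=
    (Algebra.adjoin k (Set.range φ)).exists_isTranscendenceBasis_of_adjoin_eq_top
    (s := Set.range (X : σ → MvPolynomial σ k)) adjoin_range_X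
  have hfin : t.Finite := (Set.finite_range _).subset ht
  have := hfin.fintype
  have hcard := Subalgebra.toNat_trdeg_add_card _ hbasis (n := Fintype.card σ) (by simp)
  have hrn := (Matrix.of fun i j =>
    algebraMap (MvPolynomial σ k) K (pderiv j (φ i))).mulVecLin.finrank_range_add_finrank_ker
  rw [Module.finrank_fintype_fun_eq_card] at hrn
  suffices h : Module.finrank K (LinearMap.ker (Matrix.of fun i j =>
      algebraMap (MvPolynomial σ k) K (pderiv j (φ i))).mulVecLin) ≤ Fintype.card t by
    rw [Matrix.rank]
    omega
  let ev : (σ → K) →ₗ[K] (t → K) :=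
    (Matrix.of fun (x : t) j => algebraMap (MvPolynomial σ k) K (pderiv j x.1)).mulVecLin
  have hinj : Function.Injective (ev.domRestrict (LinearMap.ker (Matrix.of fun i j =>
      algebraMap (MvPolynomial σ k) K (pderiv j (φ i))).mulVecLin)) := by
    rw [injective_iff_map_eq_zero]
    rintro ⟨a, ha⟩ hea
    have hz := (mkDerivation k a).eq_zero_of_isTranscendenceBasis hbasis
      (by
        rintro _ ⟨i, rfl⟩
        rw [mkDerivation_eq_sum]
        exact congrFun ha i)
      (fun x hx => by
        rw [mkDerivation_eq_sum]
        exact congrFun hea ⟨x, hx⟩)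
    ext j
    simpa [mkDerivation_X] using hz (X j)
  have := LinearMap.finrank_le_finrank_of_injective hinj
  rwa [Module.finrank_fintype_fun_eq_card] at this

theorem LinearMap.BilinForm.exists_orthogonal_basis_head_eq {K V : Type*} [Field K]
    [AddCommGroup V] [Module K V] [FiniteDimensional K V] [Invertible (2 : K)]
    {B : LinearMap.BilinForm K V} (hB : B.IsSymm) {x : V} (hx : B x x ≠ 0) {d : ℕ}
    (hd : Module.finrank K V = d + 1) :
    ∃ v : Module.Basis (Fin (d + 1)) K V, v 0 = x ∧ B.IsOrthoᵢ v := by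
  rw [← Submodule.finrank_add_eq_of_isCompl
      (LinearMap.BilinForm.isCompl_span_singleton_orthogonal hx).symm,
    finrank_span_singleton (ne_zero_of_map hx)] at hd
  let B' := B.domRestrict₁₂ ((K ∙ x).orthogonalBilin B) ((K ∙ x).orthogonalBilin B)
  have hd' : Module.finrank K ((K ∙ x).orthogonalBilin B) = d := Nat.succ.inj hd
  obtain ⟨v', hv'⟩ : ∃ v : Module.Basis (Fin d) K ((K ∙ x).orthogonalBilin B), B'.IsOrthoᵢ v := by
    rw [← hd']
    exact LinearMap.BilinForm.exists_orthogonal_basis (⟨fun y z => hB.eq y z⟩ : B'.IsSymm)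
  let b := Module.Basis.mkFinCons x v'
      (by
        rintro c y hy hc
        rw [add_eq_zero_iff_neg_eq] at hc
        rw [← hc, Submodule.neg_mem_iff] at hy
        have := (LinearMap.BilinForm.isCompl_span_singleton_orthogonal hx).disjoint
        rw [Submodule.disjoint_def] at this
        have := this (c • x) (Submodule.smul_mem _ _ <| Submodule.mem_span_singleton_self _) hy
        exact (smul_eq_zero.1 this).resolve_right fun h => hx <| h.symm ▸ map_zero _)
      (by
        intro y
        refine ⟨-B x y / B x x, fun z hz => ?_⟩
        obtain ⟨c, rfl⟩ := Submodule.mem_span_singleton.1 hz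
        rw [map_smul, LinearMap.smul_apply, map_add, map_smul, smul_eq_mul, smul_eq_mul,
          div_mul_cancel₀ _ hx, add_neg_cancel, mul_zero])
  refine ⟨b, by simp [b], ?_⟩
  rw [Module.Basis.coe_mkFinCons]
  intro j i
  refine Fin.cases ?_ (fun i => ?_) i <;> refine Fin.cases ?_ (fun j => ?_) j <;> intro hij <;>
    simp only [Function.onFun, Fin.cons_zero, Fin.cons_succ, Function.comp_apply]
  · exact (hij rfl).elim
  · rw [← hB.eq]
    exact (v' j).prop _ (Submodule.mem_span_singleton_self x)
  · exact (v' i).prop _ (Submodule.mem_span_singleton_self x)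
  · exact hv' (ne_of_apply_ne _ hij)

/-- A symmetric matrix is diagonalised by a congruence whose first column is a given
anisotropic vector. -/
theorem Matrix.IsSymm.exists_transpose_mul_mul_eq_diagonal {K : Type*} [Field K]
    [Invertible (2 : K)] {n : ℕ} {H : Matrix (Fin (n + 1)) (Fin (n + 1)) K} (hH : H.IsSymm)
    {p : Fin (n + 1) → K} (hp : p ⬝ᵥ H.mulVec p ≠ 0) :
    ∃ (V : Matrix (Fin (n + 1)) (Fin (n + 1)) K) (δ : Fin (n + 1) → K),
      IsUnit V.det ∧ V.col 0 = p ∧ V.transpose * H * V = Matrix.diagonal δ := by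
  have hB : (Matrix.toBilin' H).IsSymm := by
    refine ⟨fun x y => ?_⟩
    simp only [Matrix.toBilin'_apply']
    rw [Matrix.dotProduct_mulVec, ← Matrix.mulVec_transpose, hH.eq, dotProduct_comm]
  obtain ⟨v, hv0, hv⟩ := LinearMap.BilinForm.exists_orthogonal_basis_head_eq hB (x := p)
    (by rwa [Matrix.toBilin'_apply']) (by simp : Module.finrank K (Fin (n + 1) → K) = n + 1)
  refine ⟨(Pi.basisFun K _).toMatrix v, fun i => v i ⬝ᵥ H.mulVec (v i), ?_, ?_, ?_⟩
  · rw [← Matrix.isUnit_iff_isUnit_det]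
    exact IsUnit.of_mul_eq_one _ (Module.Basis.toMatrix_mul_toMatrix_flip _ v)
  · rw [← hv0]; ext i; simp [Module.Basis.toMatrix_apply]
  · ext i j
    have h1 : ((((Pi.basisFun K (Fin (n + 1))).toMatrix v).transpose * H *
        (Pi.basisFun K (Fin (n + 1))).toMatrix v) i j) = v i ⬝ᵥ H.mulVec (v j) := by
      rw [Matrix.dotProduct_mulVec]
      rfl
    rw [h1, Matrix.diagonal_apply]
    split_ifs with h
    · rw [h]
    · have := hv h
      rwa [Function.onFun, Matrix.toBilin'_apply'] at this

theorem Fin.exists_embedding_succAbove {n s : ℕ} (hn : 0 < n) (hs : s ≤ n)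
    (T : Finset (Fin (n + 1))) (h0 : 0 ∈ T) (hsT : s ≤ T.card) :
    ∃ (j : Fin (n + 1)) (e : Fin s ↪ Fin n), j ≠ 0 ∧ ∀ a, j.succAbove (e a) ∈ T := by
  classical
  obtain ⟨j, hj, hjT⟩ : ∃ j : Fin (n + 1), j ≠ 0 ∧
      s ≤ (Finset.univ.filter fun k : Fin n => j.succAbove k ∈ T).card := by
    have key : ∀ j : Fin (n + 1), T.erase j ⊆
        (Finset.univ.filter fun k : Fin n => j.succAbove k ∈ T).image j.succAbove := by
      intro j i hi
      obtain ⟨hij, hiT⟩ := Finset.mem_erase.mp hi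
      obtain ⟨k, rfl⟩ := Fin.exists_succAbove_eq hij
      exact Finset.mem_image.mpr ⟨k, by simpa using hiT, rfl⟩
    have key' := fun j => (Finset.card_le_card (key j)).trans Finset.card_image_le
    by_cases h : ∃ j : Fin (n + 1), j ≠ 0 ∧ j ∉ T
    · obtain ⟨j, hj, hjT⟩ := h
      refine ⟨j, hj, le_trans ?_ (key' j)⟩
      rwa [Finset.erase_eq_of_notMem hjT]
    · push Not at h
      have hT : T = Finset.univ := Finset.eq_univ_of_forall fun j =>
        (eq_or_ne j 0).elim (fun hj => hj ▸ h0) (h j)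
      exact ⟨Fin.last n, Fin.ne_of_gt (by simpa [Fin.lt_def] using hn), by simpa [hT] using hs⟩
  exact ⟨j, (Finset.orderEmbOfCardLe _ hjT).toEmbedding, hj, fun a => by
    simpa using Finset.orderEmbOfCardLe_mem _ hjT a⟩


/-- A symmetric form of rank at least `s` that is anisotropic at `p` restricts to a hyperplane
through `p` with rank at least `s`, if `s` is at most the dimension of the hyperplane. -/
theorem Matrix.IsSymm.exists_submatrix_det_ne_zero {K : Type*} [Field K]
    [Invertible (2 : K)] {n s : ℕ} {H : Matrix (Fin (n + 1)) (Fin (n + 1)) K} (hH : H.IsSymm)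
    {p : Fin (n + 1) → K} (hp : p ⬝ᵥ H.mulVec p ≠ 0) (hn : 0 < n) (hs : s ≤ n) (hsH : s ≤ H.rank) :
    ∃ (M : Matrix (Fin (n + 1)) (Fin n) K) (i : Fin n) (e : Fin s → Fin n),
      M.col i = p ∧ ((M.transpose * H * M).submatrix e e).det ≠ 0 := by
  classical
  obtain ⟨V, δ, hV, hV0, hVH⟩ := hH.exists_transpose_mul_mul_eq_diagonal hp
  have hrank : H.rank = Fintype.card {i // δ i ≠ 0} := by
    rw [← Matrix.rank_diagonal, ← hVH, Matrix.rank_mul_eq_left_of_isUnit_det _ _ hV,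
      Matrix.rank_mul_eq_right_of_isUnit_det _ _ (by rwa [Matrix.det_transpose])]
  have hent : ∀ i j, (V.transpose * H * V) i j = V.col i ⬝ᵥ H.mulVec (V.col j) := by
    intro i j
    rw [Matrix.dotProduct_mulVec]
    rfl
  have h0 : δ 0 ≠ 0 := by
    have := hent 0 0
    rw [hVH, Matrix.diagonal_apply_eq, hV0] at this
    rwa [this]
  rw [hrank, Fintype.card_subtype] at hsH
  obtain ⟨j, e, hj, he⟩ := Fin.exists_embedding_succAbove hn hs _ (by simpa using h0) hsH
  obtain ⟨i, hi⟩ := Fin.exists_succAbove_eq hj.symm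
  refine ⟨V.submatrix id j.succAbove, i, e, ?_, ?_⟩
  · rw [← hV0, ← hi]; rfl
  · have : ((V.submatrix id j.succAbove).transpose * H * V.submatrix id j.succAbove).submatrix e e =
        (Matrix.diagonal δ).submatrix (j.succAbove ∘ e) (j.succAbove ∘ e) := by
      rw [← hVH]
      rfl
    rw [this, Matrix.submatrix_diagonal _ _ (j.succAbove_right_injective.comp e.injective),
      Matrix.det_diagonal, Finset.prod_ne_zero_iff]
    intro a _
    simpa using he a

theorem MvPolynomial.pderiv_comm {R σ : Type*} [CommRing R] (i j : σ) (p : MvPolynomial σ R) :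
    pderiv i (pderiv j p) = pderiv j (pderiv i p) := by
  classical
  let D (i : σ) : Derivation R (MvPolynomial σ R) (MvPolynomial σ R) := pderiv i
  have h : ⁅D i, D j⁆ = 0 := by
    refine derivation_ext fun k => ?_
    simp [D, Derivation.commutator_apply, pderiv_X, Pi.single_apply, apply_ite]
  have := DFunLike.congr_fun h p
  simpa [D, Derivation.commutator_apply, sub_eq_zero] using this

/-- The Hessian matrix of a polynomial. -/
noncomputable def MvPolynomial.hessian {R σ : Type*} [CommRing R] (F : MvPolynomial σ R) :
    Matrix σ σ (MvPolynomial σ R) :=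
  Matrix.of fun i j => pderiv j (pderiv i F)

theorem MvPolynomial.isSymm_hessian {R σ : Type*} [CommRing R] (F : MvPolynomial σ R) :
    F.hessian.IsSymm :=
  Matrix.IsSymm.ext fun i j => pderiv_comm i j F

theorem MvPolynomial.IsHomogeneous.dotProduct_hessian_mulVec {R σ : Type*} [CommRing R] [Fintype σ]
    {F : MvPolynomial σ R} {d : ℕ} (hF : F.IsHomogeneous d) (p : σ → R) :
    p ⬝ᵥ (F.hessian.map (eval p)).mulVec p = d * (d - 1 : ℕ) * eval p F := by
  have h1 : ∀ i, (F.hessian.map (eval p)).mulVec p i = (d - 1 : ℕ) * eval p (pderiv i F) := by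
    intro i
    have := congrArg (eval p) (hF.pderiv (i := i)).sum_X_mul_pderiv
    simp only [map_sum, map_mul, eval_X, nsmul_eq_mul, map_natCast] at this
    rw [← this]
    exact Finset.sum_congr rfl fun k _ => mul_comm _ _
  have h2 := congrArg (eval p) hF.sum_X_mul_pderiv
  simp only [map_sum, map_mul, eval_X, nsmul_eq_mul, map_natCast] at h2
  simp only [dotProduct, h1]
  rw [mul_comm (d : R), mul_assoc, ← h2, Finset.mul_sum]
  exact Finset.sum_congr rfl fun k _ => by ring

theorem Matrix.exists_forall_le_rank_map_eval {k σ m n K : Type*} [Field k] [Fintype m] [Fintype n]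
    [Field K] [Algebra (MvPolynomial σ k) K]
    (A : Matrix m n (MvPolynomial σ k)) :
    ∃ h : MvPolynomial σ k, h ≠ 0 ∧ ∀ p, eval p h ≠ 0 →
      (A.map (algebraMap (MvPolynomial σ k) K)).rank ≤ (A.map (eval p)).rank := by
  obtain ⟨e, f, hef⟩ :=
    (A.map (algebraMap (MvPolynomial σ k) K)).exists_submatrix_det_ne_zero le_rfl
  refine ⟨(A.submatrix e f).det, fun h => hef ?_, fun p hp => ?_⟩
  · rw [Matrix.submatrix_map, ← RingHom.mapMatrix_apply, ← RingHom.map_det, h, map_zero]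
  · rw [RingHom.map_det, RingHom.mapMatrix_apply, ← Matrix.submatrix_map] at hp
    refine le_trans (le_of_eq ?_) (Matrix.rank_submatrix_le _ e f)
    rw [Matrix.rank_of_isUnit _ ((Matrix.isUnit_iff_isUnit_det _).mpr hp.isUnit)]
    simp

theorem MvPolynomial.eval_hessian_aeval {R : Type*} [CommRing R] {σ τ : Type*} [Fintype σ]
    [Fintype τ] (F : MvPolynomial σ R) (M : Matrix σ τ R) (x : τ → R) :
    (hessian (aeval (fun i => ∑ j, C (M i j) * X j) F)).map (eval x) =
      M.transpose * F.hessian.map (eval (M.mulVec x)) * M := by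
  classical
  have hl : ∀ i a, pderiv a (∑ j, C (M i j) * X j : MvPolynomial τ R) = C (M i a) := by
    intro i a
    simp [pderiv_X, Pi.single_apply]
  have he : ∀ p : MvPolynomial σ R, eval x (aeval (fun i => ∑ j, C (M i j) * X j) p) =
      eval (M.mulVec x) p := by
    intro p
    have : (fun i => eval x (∑ j, C (M i j) * X j)) = M.mulVec x := by
      funext i
      simp [Matrix.mulVec, dotProduct]
    rw [← this, ← aeval_eq_eval, ← aeval_eq_eval]
    exact congrArg (fun f : MvPolynomial σ R →ₐ[R] R => f p)
      (comp_aeval _ (aeval x : MvPolynomial τ R →ₐ[R] R))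
  ext a b
  simp only [hessian, Matrix.map_apply, Matrix.of_apply, pderiv_aeval, hl, map_sum,
    Derivation.leibniz, pderiv_C, mul_zero, zero_add, smul_eq_mul, Matrix.mul_apply,
    Matrix.transpose_apply, map_mul, eval_C, he, Finset.mul_sum, Finset.sum_mul]
  conv_rhs => rw [Finset.sum_comm]
  exact Finset.sum_congr rfl fun k _ => Finset.sum_congr rfl fun i _ => by ring

/-- If the Hessian of a form has rank at least `s` and `s ≤ n`, then so does the Hessian of its
restriction to a general hyperplane. -/
theorem MvPolynomial.exists_forall_algebraicIndependent_pderiv {k : Type*} [Field k]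
    [CharZero k]
    {n d s : ℕ} (hn : 0 < n) (hd : 1 < d) (hs : s ≤ n) {F : MvPolynomial (Fin (n + 1)) k}
    (hF0 : F ≠ 0)
    (hF : F.IsHomogeneous d)
    (hsF : s ≤ Cardinal.toNat (Algebra.trdeg k
      (Algebra.adjoin k (Set.range fun i => pderiv i F)))) :
    ∃ q : MvPolynomial (Fin (n + 1) × Fin n) k, q ≠ 0 ∧ ∃ e : Fin s → Fin n,
      ∀ M : Matrix (Fin (n + 1)) (Fin n) k, eval (fun p => M p.1 p.2) q ≠ 0 →
        AlgebraicIndependent k fun a =>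
          pderiv (e a) (aeval (fun i => ∑ j, C (M i j) * X j) F : MvPolynomial (Fin n) k) := by
  obtain ⟨h, hh, hr⟩ :=
    F.hessian.exists_forall_le_rank_map_eval
      (K := FractionRing (MvPolynomial (Fin (n + 1)) k))
  obtain ⟨p, hp⟩ : ∃ p, eval p (h * F) ≠ 0 := by
    by_contra! H
    exact mul_ne_zero hh hF0 (MvPolynomial.funext fun p => by rw [H, map_zero])
  rw [map_mul, mul_ne_zero_iff] at hp
  have hsH := (hsF.trans (trdeg_adjoin_le_rank
    (K := FractionRing (MvPolynomial (Fin (n + 1)) k)) _)).trans (hr p hp.1)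
  have : Invertible (2 : k) := invertibleOfNonzero two_ne_zero
  obtain ⟨M₀, i₀, e, hM₀, hdet⟩ := Matrix.IsSymm.exists_submatrix_det_ne_zero
    (F.isSymm_hessian.map (eval p)) (by
      rw [hF.dotProduct_hessian_mulVec]
      refine mul_ne_zero (mul_ne_zero ?_ ?_) hp.2 <;> rw [Nat.cast_ne_zero] <;> omega) hn hs hsH
  let U : Matrix (Fin (n + 1)) (Fin n) (MvPolynomial (Fin (n + 1) × Fin n) k) :=
    Matrix.of fun i j => X (i, j)
  let q := ((U.transpose * F.hessian.map (aeval (U.col i₀)) * U).submatrix e e).det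
  have hq : ∀ M : Matrix (Fin (n + 1)) (Fin n) k, eval (fun p => M p.1 p.2) q =
      ((M.transpose * F.hessian.map (eval (M.col i₀)) * M).submatrix e e).det := by
    intro M
    have hU : U.map (eval (fun p => M p.1 p.2)) = M := by
      ext i j
      simp [U]
    have hUt : U.transpose.map (eval (fun p => M p.1 p.2)) = M.transpose :=
      congrArg Matrix.transpose hU
    have hH : (F.hessian.map (aeval (U.col i₀))).map (eval (fun p => M p.1 p.2)) =
        F.hessian.map (eval (M.col i₀)) := by
      ext i j
      simp only [Matrix.map_apply]
      rw [← aeval_eq_eval, ← aeval_eq_eval]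
      refine (congrArg (fun f : MvPolynomial _ k →ₐ[k] k => f (F.hessian i j))
        (comp_aeval _ (aeval _ : MvPolynomial _ k →ₐ[k] k))).trans ?_
      congr 2
      funext i
      simp [U]
    rw [RingHom.map_det, RingHom.mapMatrix_apply, ← Matrix.submatrix_map, Matrix.map_mul,
      Matrix.map_mul, hUt, hU, hH]
  refine ⟨q, fun h0 => hdet ?_, e, fun M hM => ?_⟩
  · rw [← hM₀, ← hq, h0, map_zero]
  · refine algebraicIndependent_of_det_ne_zero _ e fun h0 => hM ?_
    rw [hq]
    have h1 := eval_hessian_aeval F M (Pi.single i₀ 1)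
    rw [Matrix.mulVec_single_one] at h1
    rw [← h1, Matrix.submatrix_map, ← RingHom.mapMatrix_apply, ← RingHom.map_det]
    exact (congrArg _ h0).trans (map_zero _)

theorem Algebra.trdeg_adjoin_range_le.{u} {k A : Type u} [Field k] [CommRing A] [Nontrivial A]
    [Algebra k A] {n : ℕ} (φ : Fin n → A) :
    Algebra.trdeg k (Algebra.adjoin k (Set.range φ)) ≤ n := by
  rw [Algebra.adjoin_range_eq_range_aeval]
  exact (trdeg_le_of_surjective _
    (aeval φ : MvPolynomial (Fin n) k →ₐ[k] A).rangeRestrict_surjective).trans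
    (by simp)

theorem AlgHom.trdeg_le_of_le_map.{u} {k A B : Type u} [Field k] [CommRing A] [CommRing B]
    [Nontrivial A] [Nontrivial B] [Algebra k A] [Algebra k B] (f : A →ₐ[k] B)
    {S : Subalgebra k A} {T : Subalgebra k B}
    (h : T ≤ S.map f) : Algebra.trdeg k T ≤ Algebra.trdeg k S :=
  (trdeg_le_of_injective (Subalgebra.inclusion h) (Subalgebra.inclusion_injective h)).trans
    (trdeg_le_of_surjective (f.subalgebraMap S) (AlgHom.subalgebraMap_surjective S f))

theorem MvPolynomial.adjoin_pderiv_aeval_le_map {R : Type*} [CommRing R] {σ τ : Type*} [Fintype σ]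
    [Fintype τ] (F : MvPolynomial σ R) (M : σ → τ → R) :
    Algebra.adjoin R (Set.range fun a => pderiv a
        (aeval (fun i => ∑ j, C (M i j) * X j) F : MvPolynomial τ R)) ≤
      (Algebra.adjoin R (Set.range fun i => pderiv i F)).map
        (aeval (fun i => ∑ j, C (M i j) * X j) : MvPolynomial σ R →ₐ[R] MvPolynomial τ R) := by
  classical
  rw [Algebra.adjoin_le_iff]
  rintro _ ⟨a, rfl⟩
  dsimp only
  rw [pderiv_aeval]
  refine sum_mem fun i _ => mul_mem ?_ ?_
  · exact ⟨_, Algebra.subset_adjoin ⟨i, rfl⟩, rfl⟩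
  · have : pderiv a (∑ j, C (M i j) * X j : MvPolynomial τ R) = algebraMap R _ (M i a) := by
      simp [pderiv_X, Pi.single_apply]
    rw [this]
    exact Subalgebra.algebraMap_mem _ _

theorem stmt13 {N d : ℕ} (hN : 0 < N) (hd : 1 < d)
    (F : MvPolynomial (Fin (N + 1)) ℂ)
    (hFirr : Irreducible F) (hFhom : F.IsHomogeneous d) :
    ∃ q : MvPolynomial (Fin (N + 1) × Fin N) ℂ, q ≠ 0 ∧
      ∀ M : Fin (N + 1) → Fin N → ℂ,
        eval (fun p : Fin (N + 1) × Fin N => M p.1 p.2) q ≠ 0 →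
        -- G_M : the equation of the hyperplane section Y_L
        ∀ G : MvPolynomial (Fin N) ℂ,
          G = aeval (fun i : Fin (N + 1) =>
              ∑ j : Fin N, MvPolynomial.C (M i j) * MvPolynomial.X j) F →
          (adim (zcl (Set.range (polarMap F))) = ((N + 1 : ℕ) : ℕ∞) →
            adim (zcl (Set.range (polarMap G))) = ((N : ℕ) : ℕ∞)) ∧
          ((adim (zcl (Set.range (polarMap F))) = ((N + 1 : ℕ) : ℕ∞) ∧
              adim (zcl (Set.range (polarMap G))) = ((N : ℕ) : ℕ∞)) ∨
            adim (zcl (Set.range (polarMap F)))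
              = adim (zcl (Set.range (polarMap G)))) := by
  have htoNat : ∀ {n : ℕ} {c : Cardinal}, c ≤ n → Cardinal.toNat c ≤ n := fun {n c} h => by
    simpa using Cardinal.toNat_le_toNat h Cardinal.natCast_lt_aleph0
  have hadim : ∀ {n : ℕ} (P : MvPolynomial (Fin n) ℂ), adim (zcl (Set.range (polarMap P))) =
      ((Cardinal.toNat (Algebra.trdeg ℂ
        (Algebra.adjoin ℂ (Set.range fun i => pderiv i P))) : ℕ) : ℕ∞) :=
    fun P => adim_zcl_range fun i => pderiv i P
  have hF := Algebra.trdeg_adjoin_range_le (k := ℂ) fun i => pderiv i F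
  obtain ⟨q, hq, e, hqe⟩ := exists_forall_algebraicIndependent_pderiv hN hd
    (min_le_right (Cardinal.toNat (Algebra.trdeg ℂ
      (Algebra.adjoin ℂ (Set.range fun i => pderiv i F)))) N)
    hFirr.ne_zero hFhom (min_le_left _ _)
  refine ⟨q, hq, ?_⟩
  rintro M hM G rfl
  have hind := hqe M hM
  have hle := Cardinal.toNat_le_toNat
    (AlgHom.trdeg_le_of_le_map _ (adjoin_pderiv_aeval_le_map F M))
    (hF.trans_lt Cardinal.natCast_lt_aleph0)
  set G := aeval (fun i : Fin (N + 1) =>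
    ∑ j : Fin N, MvPolynomial.C (M i j) * MvPolynomial.X j) F
  have hG := Algebra.trdeg_adjoin_range_le (k := ℂ) fun i => pderiv i G
  have hge := AlgebraicIndependent.lift_cardinalMk_le_trdeg (R := ℂ)
    (x := fun a => (⟨pderiv (e a) G, Algebra.subset_adjoin ⟨e a, rfl⟩⟩ :
      Algebra.adjoin ℂ (Set.range fun i => pderiv i G)))
    (AlgebraicIndependent.of_comp (Subalgebra.val _) hind)
  rw [Cardinal.mk_fin, Cardinal.lift_natCast, Cardinal.lift_id] at hge
  have hge' := Cardinal.toNat_le_toNat hge (hG.trans_lt Cardinal.natCast_lt_aleph0)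
  rw [Cardinal.toNat_natCast] at hge'
  rw [hadim, hadim]
  have hF' := htoNat hF
  have hG' := htoNat hG
  generalize Cardinal.toNat (Algebra.trdeg ℂ
    (Algebra.adjoin ℂ (Set.range fun i => pderiv i G))) = g at *
  generalize Cardinal.toNat (Algebra.trdeg ℂ
    (Algebra.adjoin ℂ (Set.range fun i => pderiv i F))) = r at *
  norm_cast
  omega
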